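/- arXiv:1503.02386 — 4 statements merged into one kernel-verified Lean document; each statement's English description precedes it below -/
import Mathlib

section
/- Let F be a field, W a finite-dimensional vector space over F, and fix natural numbers n, k, g, s with k ≥ 1 and s ≥ 2. Let V be a function assigning to each subset S of a fixed n-element index set a linear subspace V(S) of W, satisfying: (i) V(S₁) ∩ V(S₂) = V(S₁ ∩ S₂) for all S₁, S₂; (ii) V(∅) = 0; (iii) dim V(S) = k·|S| + 1 − g for every S with k·|S| ≥ 2g − 1. Assume k(s−1) ≥ 2g − 1. Then for any two distinct subsets S₁ ≠ S₂ of size s, dist(V(S₁), V(S₂)) ≥ 2k. -/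
/-- For the family of Riemann–Roch-type subspaces `V(S)` with `k(s−1) ≥ 2g − 1`:
any two distinct `s`-subsets `S₁ ≠ S₂` satisfy `dist(V(S₁), V(S₂)) ≥ 2k`. -/
theorem kk_dist_ge (F W ι : Type*) [Field F] [AddCommGroup W] [Module F W]
    [FiniteDimensional F W] [Fintype ι] [DecidableEq ι] (n k g s : ℕ)
    (hn : Fintype.card ι = n) (hk : 1 ≤ k) (hs : 2 ≤ s)
    (V : Finset ι → Submodule F W)
    (hinter : ∀ S₁ S₂ : Finset ι, V S₁ ⊓ V S₂ = V (S₁ ∩ S₂))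
    (hempty : V ∅ = ⊥)
    (hdim : ∀ S : Finset ι, (2 * g : ℤ) - 1 ≤ (k : ℤ) * S.card →
      (Module.finrank F ↥(V S) : ℤ) = (k : ℤ) * S.card + 1 - g)
    (hks : (2 * g : ℤ) - 1 ≤ (k : ℤ) * ((s : ℤ) - 1))
    (S₁ S₂ : Finset ι) (hS₁ : S₁.card = s) (hS₂ : S₂.card = s) (hne : S₁ ≠ S₂) :
    (2 * k : ℤ) ≤
      (Module.finrank F ↥(V S₁ ⊔ V S₂) : ℤ) - (Module.finrank F ↥(V S₁ ⊓ V S₂) : ℤ) := by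
  obtain ⟨x, hx₁, hx₂⟩ : ∃ x ∈ S₁, x ∉ S₂ := by
    by_contra! h
    exact hne (Finset.eq_of_subset_of_card_le h (by omega))
  have hcard : ((S₁.erase x).card : ℤ) = s - 1 := by
    rw [Finset.card_erase_of_mem hx₁, hS₁]
    omega
  have hsub : S₁ ∩ S₂ ⊆ S₁.erase x := fun y hy => by
    rw [Finset.mem_inter] at hy
    exact Finset.mem_erase.2 ⟨fun h => hx₂ (h ▸ hy.2), hy.1⟩
  have hle : V S₁ ⊓ V S₂ ≤ V (S₁.erase x) := by
    rw [hinter, ← inf_eq_left, hinter, Finset.inter_eq_left.2 hsub]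
  have hfin := Submodule.finrank_mono hle
  have hsup := Submodule.finrank_sup_add_finrank_inf_eq (V S₁) (V S₂)
  have hdimT := hdim (S₁.erase x) (by rwa [hcard])
  rw [hcard] at hdimT
  have hdim₁ := hdim S₁ (by rw [hS₁]; linarith)
  have hdim₂ := hdim S₂ (by rw [hS₂]; linarith)
  rw [hS₁] at hdim₁
  rw [hS₂] at hdim₂
  zify at hfin hsup
  linarith
end

section
/- Let F be a field, W a finite-dimensional vector space over F, and fix natural numbers n, k, g, s with k ≥ 1, s ≥ 2 and n ≥ s + 1. Let V be a function assigning to each subset S of a fixed n-element index set a linear subspace V(S) of W, satisfying: (i) V(S₁) ∩ V(S₂) = V(S₁ ∩ S₂) for all S₁, S₂; (ii) V(∅) = 0; (iii) dim V(S) = k·|S| + 1 − g for every S with k·|S| ≥ 2g − 1. Assume k(s−1) ≥ 2g − 1. Then the minimum of dist(V(S₁), V(S₂)) over all pairs of distinct subsets S₁ ≠ S₂ of size s equals 2k; in particular there exist distinct s-subsets S₁, S₂ with dist(V(S₁), V(S₂)) = 2k. -/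
/-- For subspaces of equal dimension `d`, the Koetter–Kschischang distance is twice the
codimension of the intersection. -/
theorem Submodule.finrank_sup_sub_finrank_inf {F W : Type*} [Field F] [AddCommGroup W]
    [Module F W] [FiniteDimensional F W] {A B : Submodule F W} {d : ℤ}
    (hA : (Module.finrank F A : ℤ) = d) (hB : (Module.finrank F B : ℤ) = d) :
    (Module.finrank F ↥(A ⊔ B) : ℤ) - (Module.finrank F ↥(A ⊓ B) : ℤ) =
      2 * (d - Module.finrank F ↥(A ⊓ B)) := by
  have := Submodule.finrank_sup_add_finrank_inf_eq A B
  omega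

/-- Minimum distance of the code `C_{k,s}`: under `k(s−1) ≥ 2g − 1`, `s ≥ 2`,
`n ≥ s + 1`, the minimum of `dist(V(S₁), V(S₂))` over distinct `s`-subsets is
exactly `2k`; in particular the minimum is attained. -/
theorem kk_min_dist (F W ι : Type*) [Field F] [AddCommGroup W] [Module F W]
    [FiniteDimensional F W] [Fintype ι] [DecidableEq ι] (n k g s : ℕ)
    (hn : Fintype.card ι = n) (hk : 1 ≤ k) (hs : 2 ≤ s) (hns : s + 1 ≤ n)
    (V : Finset ι → Submodule F W)
    (hinter : ∀ S₁ S₂ : Finset ι, V S₁ ⊓ V S₂ = V (S₁ ∩ S₂))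
    (hempty : V ∅ = ⊥)
    (hdim : ∀ S : Finset ι, (2 * g : ℤ) - 1 ≤ (k : ℤ) * S.card →
      (Module.finrank F ↥(V S) : ℤ) = (k : ℤ) * S.card + 1 - g)
    (hks : (2 * g : ℤ) - 1 ≤ (k : ℤ) * ((s : ℤ) - 1)) :
    (∀ S₁ S₂ : Finset ι, S₁.card = s → S₂.card = s → S₁ ≠ S₂ →
      (2 * k : ℤ) ≤
        (Module.finrank F ↥(V S₁ ⊔ V S₂) : ℤ) - (Module.finrank F ↥(V S₁ ⊓ V S₂) : ℤ)) ∧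
    (∃ S₁ S₂ : Finset ι, S₁.card = s ∧ S₂.card = s ∧ S₁ ≠ S₂ ∧
      (Module.finrank F ↥(V S₁ ⊔ V S₂) : ℤ) - (Module.finrank F ↥(V S₁ ⊓ V S₂) : ℤ) =
        2 * k) := by
  have hmono : Monotone V := fun S T h => by
    rw [← inf_eq_left, hinter, Finset.inter_eq_left.mpr h]
  have hdim_s (S : Finset ι) (hS : S.card = s) :
      (Module.finrank F ↥(V S) : ℤ) = (k : ℤ) * s + 1 - g := by
    rw [hdim S (by rw [hS]; linarith), hS]
  have hdim_pred (T : Finset ι) (hT : T.card = s - 1) :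
      (Module.finrank F ↥(V T) : ℤ) = (k : ℤ) * (s - 1) + 1 - g := by
    have hcast : (T.card : ℤ) = s - 1 := by omega
    rw [hdim T (by rwa [hcast]), hcast]
  refine ⟨fun S₁ S₂ h₁ h₂ hne => ?_, ?_⟩
  · have hlt : (S₁ ∩ S₂).card < s := by
      refine h₁ ▸ Finset.card_lt_card (Finset.inter_subset_left.ssubset_of_ne fun h => hne ?_)
      exact Finset.eq_of_subset_of_card_le (Finset.inter_eq_left.mp h) (by omega)
    obtain ⟨T, hT, -, hTcard⟩ := Finset.exists_subsuperset_card_eq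
      (Finset.inter_subset_left : S₁ ∩ S₂ ⊆ S₁) (n := s - 1) (by omega) (by omega)
    have hle : (Module.finrank F ↥(V (S₁ ∩ S₂)) : ℤ) ≤ Module.finrank F ↥(V T) :=
      mod_cast Submodule.finrank_mono (hmono hT)
    rw [Submodule.finrank_sup_sub_finrank_inf (hdim_s S₁ h₁) (hdim_s S₂ h₂), hinter]
    linarith [hdim_pred T hTcard]
  · obtain ⟨U, -, hU⟩ := Finset.exists_subset_card_eq
      (s := (Finset.univ : Finset ι)) (n := s + 1) (by rwa [Finset.card_univ, hn])
    obtain ⟨a, ha, b, hb, hab⟩ := Finset.one_lt_card.mp (by omega : 1 < U.card)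
    have hcard_a : (U.erase a).card = s := by rw [Finset.card_erase_of_mem ha]; omega
    have hcard_b : (U.erase b).card = s := by rw [Finset.card_erase_of_mem hb]; omega
    have hcard_inter : (U.erase a ∩ U.erase b).card = s - 1 := by
      have : U.erase a ∩ U.erase b = (U.erase a).erase b := by
        ext x; simp only [Finset.mem_inter, Finset.mem_erase]; tauto
      rw [this, Finset.card_erase_of_mem (Finset.mem_erase.mpr ⟨hab.symm, hb⟩), hcard_a]
    refine ⟨U.erase a, U.erase b, hcard_a, hcard_b,
      fun h => hab ((Finset.erase_inj U ha).mp h), ?_⟩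
    rw [Submodule.finrank_sup_sub_finrank_inf (hdim_s _ hcard_a) (hdim_s _ hcard_b), hinter,
      hdim_pred _ hcard_inter]
    ring
end

section
/- Let F be a field, W a finite-dimensional vector space over F, and fix natural numbers n, k, g, s with k ≥ 1 and s ≥ 1. Let V be a function assigning to each subset S of a fixed n-element index set a linear subspace V(S) of W, satisfying: (i) V(S₁) ∩ V(S₂) = V(S₁ ∩ S₂) for all S₁, S₂; (ii) V(∅) = 0; (iii) dim V(S) = k·|S| + 1 − g for every S with k·|S| ≥ 2g − 1. Assume k·s ≥ 2g − 1, and additionally k(s−1) ≥ 2g − 1 in case s ≥ 2. Then the assignment S ↦ V(S) is injective on subsets of size s; consequently the code C_{k,s} = {V(S) : S a subset of size s} has cardinality equal to the binomial coefficient C(n, s). -/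
/-- The assignment `S ↦ V(S)` is injective on `s`-subsets, hence the code
`C_{k,s} = {V(S) : |S| = s}` has exactly `C(n, s)` elements. -/
theorem kk_code_size (F W ι : Type*) [Field F] [AddCommGroup W] [Module F W]
    [FiniteDimensional F W] [Fintype ι] [DecidableEq ι] (n k g s : ℕ)
    (hn : Fintype.card ι = n) (hk : 1 ≤ k) (hs : 1 ≤ s)
    (V : Finset ι → Submodule F W)
    (hinter : ∀ S₁ S₂ : Finset ι, V S₁ ⊓ V S₂ = V (S₁ ∩ S₂))
    (hempty : V ∅ = ⊥)
    (hdim : ∀ S : Finset ι, (2 * g : ℤ) - 1 ≤ (k : ℤ) * S.card →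
      (Module.finrank F ↥(V S) : ℤ) = (k : ℤ) * S.card + 1 - g)
    (hks : (2 * g : ℤ) - 1 ≤ (k : ℤ) * s)
    (hks' : 2 ≤ s → (2 * g : ℤ) - 1 ≤ (k : ℤ) * ((s : ℤ) - 1)) :
    Set.InjOn V {S : Finset ι | S.card = s} ∧
      (V '' {S : Finset ι | S.card = s}).ncard = n.choose s := by
  have hinj : Set.InjOn V {S : Finset ι | S.card = s} := by
    intro S hS T hT hST
    simp only [Set.mem_ofPred_eq] at hS hT
    by_contra hne
    have hlt : (S ∩ T).card < s := by
      refine lt_of_le_of_ne (hS ▸ Finset.card_le_card Finset.inter_subset_left) fun h => hne ?_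
      have h₁ : S ∩ T = S := Finset.eq_of_subset_of_card_le Finset.inter_subset_left (by omega)
      have h₂ : S ∩ T = T := Finset.eq_of_subset_of_card_le Finset.inter_subset_right (by omega)
      exact h₁.symm.trans h₂
    obtain ⟨U, hU, hUS, hUcard⟩ := Finset.exists_subsuperset_card_eq
      (Finset.inter_subset_left : S ∩ T ⊆ S) (n := s - 1) (by omega) (by omega)
    have hmono : Monotone V := fun A B hAB => by
      rw [← inf_eq_left, hinter, Finset.inter_eq_left.mpr hAB]
    have hVU : V U = V S := by
      refine le_antisymm (hmono hUS) (le_trans ?_ (hmono hU))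
      rw [← hinter, ← hST, inf_idem]
    have hdS := hdim S (by rw [hS]; exact hks)
    rw [hS] at hdS
    rcases Nat.lt_or_ge s 2 with hs2 | hs2
    · obtain rfl : s = 1 := by omega
      obtain rfl : U = ∅ := Finset.card_eq_zero.mp (by omega)
      rw [← hVU, hempty, finrank_bot] at hdS
      push_cast at hdS hks
      omega
    · have hUcard' : (U.card : ℤ) = s - 1 := by omega
      have hdU := hdim U (by rw [hUcard']; exact hks' hs2)
      rw [hVU, hdS, hUcard', mul_sub_one] at hdU
      omega
  refine ⟨hinj, ?_⟩
  have hset : {S : Finset ι | S.card = s} =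
      ((Finset.univ.powersetCard s : Finset (Finset ι)) : Set (Finset ι)) := by
    ext S
    simp
  rw [hinj.ncard_image, hset, Set.ncard_coe_finset, Finset.card_powersetCard,
    Finset.card_univ, hn]
end

section
/- Let q be a prime power and let F be a finite field with q² elements. The number of points of the projective plane over F (equivalence classes of nonzero triples (x, y, z) ∈ F³ under multiplication by nonzero scalars) satisfying the homogeneous equation x^{q+1} + y^{q+1} = z^{q+1} is exactly q³ + 1. (The condition is well defined on projective classes since (λx)^{q+1} + (λy)^{q+1} − (λz)^{q+1} = λ^{q+1}(x^{q+1} + y^{q+1} − z^{q+1}).) -/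
open Finset in
/-- A nonzero element fixed by the `q`-th power map of a field with `q²` elements is a norm of
exactly `q + 1` elements. -/
lemma FiniteField.card_pow_succ_eq {F : Type*} [Field F] [Fintype F] [DecidableEq F] {q : ℕ}
    (hF : Fintype.card F = q ^ 2) {c : F} (hc : c ≠ 0) (hcq : c ^ q = c) :
    #{z : F | z ^ (q + 1) = c} = q + 1 := by
  have hq : 1 < q := by
    have := Fintype.one_lt_card (α := F)
    rw [hF] at this
    by_contra! h
    interval_cases q <;> simp at this
  obtain ⟨m, rfl⟩ : ∃ m, q = m + 1 := ⟨q - 1, by omega⟩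
  set S : Finset F := (Polynomial.nthRoots m (1 : F)).toFinset with hS
  have hmem {x : F} : x ∈ S ↔ x ^ m = 1 := by
    simp [hS, Polynomial.mem_nthRoots (show 0 < m by omega)]
  have hScard : #S ≤ m := (Multiset.toFinset_card_le _).trans (Polynomial.card_nthRoots _ _)
  have hfib (d : F) : #{z : F | z ^ (m + 1 + 1) = d} ≤ m + 2 := by
    have hsub : ({z : F | z ^ (m + 1 + 1) = d} : Finset F) ⊆
        (Polynomial.nthRoots (m + 2) d).toFinset := by
      intro z hz
      simpa [Polynomial.mem_nthRoots] using hz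
    exact (card_le_card hsub).trans
      ((Multiset.toFinset_card_le _).trans (Polynomial.card_nthRoots _ _))
  have hmaps : ∀ z ∈ (univ.erase 0 : Finset F), z ^ (m + 1 + 1) ∈ S := by
    intro z hz
    rw [hmem, ← pow_mul]
    have := FiniteField.pow_card_sub_one_eq_one z (by simpa using hz)
    rwa [hF, show (m + 1) ^ 2 - 1 = (m + 1 + 1) * m by
      rw [Nat.sub_eq_iff_eq_add (by nlinarith)]; ring] at this
  have hsum : m * (m + 2) = ∑ d ∈ S, #{z ∈ (univ.erase 0 : Finset F) | z ^ (m + 1 + 1) = d} := by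
    rw [← card_eq_sum_card_fiberwise hmaps, card_erase_of_mem (mem_univ _), card_univ, hF,
      eq_comm, Nat.sub_eq_iff_eq_add (by nlinarith)]
    ring
  refine le_antisymm (hfib c) ?_
  by_contra! hlt
  have hcS : c ∈ S := by
    rw [hmem]
    exact mul_right_cancel₀ hc (by rw [← pow_succ, hcq, one_mul])
  have hle (d : F) : #{z ∈ (univ.erase 0 : Finset F) | z ^ (m + 1 + 1) = d} ≤
      #{z : F | z ^ (m + 1 + 1) = d} := card_le_card (filter_subset_filter _ (subset_univ _))
  have : m * (m + 2) < ∑ _d ∈ S, (m + 2) := by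
    rw [hsum]
    exact sum_lt_sum (fun d _ => (hle d).trans (hfib d)) ⟨c, hcS, (hle c).trans_lt hlt⟩
  rw [sum_const, smul_eq_mul] at this
  nlinarith

/-- The `q`-th power map of a field with `q²` elements is additive. -/
lemma FiniteField.add_pow_of_card_eq_sq {F : Type*} [Field F] [Fintype F] {q : ℕ}
    (hq : IsPrimePow q) (hF : Fintype.card F = q ^ 2) (x y : F) :
    (x + y) ^ q = x ^ q + y ^ q := by
  obtain ⟨r, k, hr, hk, rfl⟩ := hq
  obtain ⟨p, _, n, hp, hcard⟩ := FiniteField.card' F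
  have hrp : r = p := by
    have : r ∣ p ^ (n : ℕ) := by
      rw [← hcard, hF, ← pow_mul]
      exact dvd_pow_self r (by omega)
    exact (Nat.prime_dvd_prime_iff_eq hr.nat_prime hp).1 (hr.nat_prime.dvd_of_dvd_pow this)
  subst hrp
  have : Fact r.Prime := ⟨hp⟩
  exact add_pow_char_pow x y r k

open Finset in
/-- The number of points of the affine cone over the Hermitian curve. -/
lemma hermitian_cone_card {F : Type*} [Field F] [Fintype F] [DecidableEq F] {q : ℕ}
    (hq : IsPrimePow q) (hF : Fintype.card F = q ^ 2) :
    #{v : (F × F) × F | v.1.1 ^ (q + 1) + v.1.2 ^ (q + 1) = v.2 ^ (q + 1)} =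
      (q ^ 3 + 1) * (q ^ 2 - 1) + 1 := by
  have hadd := FiniteField.add_pow_of_card_eq_sq hq hF
  have hq0 : q ≠ 0 := hq.ne_zero
  have hN (x : F) : (x ^ (q + 1)) ^ q = x ^ (q + 1) := by
    have := FiniteField.pow_card x
    rw [hF] at this
    calc (x ^ (q + 1)) ^ q = x ^ q ^ 2 * x ^ q := by rw [← pow_mul, ← pow_add]; congr 1; ring
      _ = x ^ (q + 1) := by rw [this, pow_succ']
  have hneg (x : F) : (-x) ^ q = -x ^ q := by
    have := hadd x (-x)
    rw [add_neg_cancel, zero_pow hq0] at this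
    exact (neg_eq_of_add_eq_zero_right this.symm).symm
  have hfib {c : F} (hc : c ^ q = c) :
      #{z : F | z ^ (q + 1) = c} = if c = 0 then 1 else q + 1 := by
    split_ifs with h
    · subst h
      simp [filter_eq']
    · exact FiniteField.card_pow_succ_eq hF h hc
  have hcone : #{w : F × F | w.1 ^ (q + 1) + w.2 ^ (q + 1) = 0} =
      1 + (q ^ 2 - 1) * (q + 1) := by
    have (x : F) : #{y : F | x ^ (q + 1) + y ^ (q + 1) = 0} = if x = 0 then 1 else q + 1 := by
      simp_rw [← neg_eq_iff_add_eq_zero, eq_comm (a := -x ^ (q + 1))]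
      rw [hfib (by rw [hneg, hN])]
      simp
    rw [← univ_product_univ, card_filter, sum_product]
    simp_rw [← card_filter, this]
    rw [← add_sum_erase univ _ (mem_univ (0 : F)), if_pos rfl,
      sum_congr rfl (fun x hx => if_neg (ne_of_mem_erase hx)), sum_const,
      card_erase_of_mem (mem_univ _), card_univ, hF, smul_eq_mul]
  have hcompl := card_filter_add_card_filter_not (s := (univ : Finset (F × F)))
    (fun w => w.1 ^ (q + 1) + w.2 ^ (q + 1) = 0)
  rw [card_univ, Fintype.card_prod, hF, hcone] at hcompl
  have hz (w : F × F) : #{z : F | w.1 ^ (q + 1) + w.2 ^ (q + 1) = z ^ (q + 1)} =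
      if w.1 ^ (q + 1) + w.2 ^ (q + 1) = 0 then 1 else q + 1 := by
    simp_rw [eq_comm (a := w.1 ^ (q + 1) + w.2 ^ (q + 1)) (b := _ ^ (q + 1))]
    exact hfib (by rw [hadd, hN, hN])
  rw [← univ_product_univ, card_filter, sum_product]
  simp_rw [← card_filter, hz]
  rw [sum_ite, sum_const, sum_const, hcone, smul_eq_mul, smul_eq_mul]
  obtain ⟨k, hk⟩ : ∃ k, q ^ 2 = k + 1 := Nat.exists_eq_add_one.2 (by positivity)
  rw [hk, Nat.add_sub_cancel] at hcompl ⊢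
  zify at hcompl hk ⊢
  rw [show (k : ℤ) = (q : ℤ) ^ 2 - 1 by linarith] at hcompl ⊢
  linear_combination (q + 1 : ℤ) * hcompl

/-- The nonzero vectors of a cone are the nonzero multiples of the representatives of its
projective points. -/
lemma Projectivization.ncard_rep_mul_card_units {F V : Type*} [Field F] [AddCommGroup V]
    [Module F V] (p : V → Prop) (hp : ∀ (u : Fˣ) (v : V), p (u • v) ↔ p v) :
    {P : Projectivization F V | p P.rep}.ncard * Nat.card Fˣ = {v : V | v ≠ 0 ∧ p v}.ncard := by
  rw [← Nat.card_coe_set_eq, ← Nat.card_coe_set_eq, ← Nat.card_prod]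
  refine Nat.card_eq_of_bijective
    (fun x : {P : Projectivization F V | p P.rep} × Fˣ =>
      (⟨x.2 • x.1.1.rep, (smul_ne_zero_iff_ne x.2).2 x.1.1.rep_nonzero, (hp _ _).2 x.1.2⟩ :
        {v : V | v ≠ 0 ∧ p v})) ⟨?_, ?_⟩
  · rintro ⟨⟨P, hP⟩, u⟩ ⟨⟨Q, hQ⟩, w⟩ h
    have h : u • P.rep = w • Q.rep := congrArg Subtype.val h
    have hPQ : P = Q := by
      rw [← P.mk_rep, ← Q.mk_rep, Projectivization.mk_eq_mk_iff]
      exact ⟨u⁻¹ * w, by rw [mul_smul, ← h, inv_smul_smul]⟩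
    subst hPQ
    have : u = w := Units.ext (smul_left_injective F P.rep_nonzero h)
    rw [this]
  · rintro ⟨v, hv, hpv⟩
    obtain ⟨a, ha⟩ := Projectivization.exists_smul_eq_mk_rep F v hv
    refine ⟨⟨⟨Projectivization.mk F v hv, ?_⟩, a⁻¹⟩, Subtype.ext ?_⟩
    · rw [Set.mem_ofPred_eq, ← ha]
      exact (hp _ _).2 hpv
    · simp [← ha]

/-- The Hermitian (Fermat) curve `x^{q+1} + y^{q+1} = z^{q+1}` in the projective
plane over a field with `q²` elements has exactly `q³ + 1` points.  The condition
is well defined on projective classes, so it is tested on a representative. -/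
theorem hermitian_curve_card (q : ℕ) (hq : IsPrimePow q)
    (F : Type*) [Field F] [Fintype F] (hF : Fintype.card F = q ^ 2) :
    {P : Projectivization F (Fin 3 → F) |
        (P.rep 0) ^ (q + 1) + (P.rep 1) ^ (q + 1) = (P.rep 2) ^ (q + 1)}.ncard =
      q ^ 3 + 1 := by
  classical
  have hproj := Projectivization.ncard_rep_mul_card_units (F := F)
    (fun v : Fin 3 → F => v 0 ^ (q + 1) + v 1 ^ (q + 1) = v 2 ^ (q + 1)) (by
      intro u v
      simp [Units.smul_def, mul_pow, ← mul_add])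
  have hunits : Nat.card Fˣ = q ^ 2 - 1 := by
    rw [Nat.card_eq_fintype_card, Fintype.card_units, hF]
  have hpos : 0 < q ^ 2 - 1 := by
    have := hq.one_lt
    exact Nat.sub_pos_of_lt (by nlinarith)
  have hcone : {v : Fin 3 → F | v 0 ^ (q + 1) + v 1 ^ (q + 1) = v 2 ^ (q + 1)}.ncard =
      (q ^ 3 + 1) * (q ^ 2 - 1) + 1 := by
    rw [← hermitian_cone_card hq hF, ← Set.ncard_coe_finset]
    refine Set.ncard_congr (fun v _ => ((v 0, v 1), v 2)) ?_ ?_ ?_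
    · intro v hv
      simpa using hv
    · intro v w _ _ h
      simp only [Prod.mk.injEq] at h
      ext i
      fin_cases i <;> simp [h]
    · rintro ⟨⟨x, y⟩, z⟩ h
      exact ⟨![x, y, z], by simpa using h, by simp⟩
  have hdiff : {v : Fin 3 → F | v ≠ 0 ∧ v 0 ^ (q + 1) + v 1 ^ (q + 1) = v 2 ^ (q + 1)} =
      {v : Fin 3 → F | v 0 ^ (q + 1) + v 1 ^ (q + 1) = v 2 ^ (q + 1)} \ {0} := by
    ext v
    simp [and_comm]
  rw [hdiff, Set.ncard_sdiff_singleton_of_mem (by simp), hcone, hunits, Nat.add_sub_cancel]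
    at hproj
  exact Nat.eq_of_mul_eq_mul_right hpos hproj
end
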